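/- Let φ : {1, …, d} → {1, …, p} be any function such that #φ^{-1}(i) = λ^t_i for every 1 ≤ i ≤ p. Then every polynomial in the deformed Tanisaki ideal ⟨𝒞^a_λ⟩ vanishes at the point (a_{φ(1)}, a_{φ(2)}, …, a_{φ(d)}) ∈ ℂ^d. -/

import Mathlib

open MvPolynomial

noncomputable section

/-- Complete homogeneous symmetric function `h_k` of a list of complex numbers. -/
def hcomp : ℕ → List ℂ → ℂ
  | 0, _ => 1
  | _ + 1, [] => 0
  | k + 1, x :: l => x * hcomp k (x :: l) + hcomp (k + 1) l
  termination_by k l => (l.length, k)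

/-- Elementary symmetric polynomial `e_r` in the variables indexed by `J ⊆ {1,…,d}`. -/
def elemSym (d : ℕ) (J : Finset (Fin d)) (r : ℕ) : MvPolynomial (Fin d) ℂ :=
  ∑ s ∈ J.powersetCard r, ∏ j ∈ s, X j

/-- The tuple `a^{(n)}` : entries `a_1,…,a_{λ_i}` for each row `i = n+1,…,ℓ` (0-indexed rows). -/
def aTuple (ℓ : ℕ) (lam : ℕ → ℕ) (a : ℕ → ℂ) (n : ℕ) : List ℂ :=
  ((List.range ℓ).drop n).flatMap fun i => (List.range (lam i)).map a

/-- `m_λ(n) = λ_{n+1} + … + λ_ℓ` (0-indexed rows `n,…,ℓ-1`). -/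
def mRem (ℓ : ℕ) (lam : ℕ → ℕ) (n : ℕ) : ℕ := ∑ i ∈ Finset.Ico n ℓ, lam i

/-- The deformed Tanisaki generator `g_{n,J,r} = Σ_{k=0}^r (−1)^k e_{r−k}(t_J) h_k(a^{(n)})`. -/
def tanGen (d ℓ : ℕ) (lam : ℕ → ℕ) (a : ℕ → ℂ) (n : ℕ) (J : Finset (Fin d)) (r : ℕ) :
    MvPolynomial (Fin d) ℂ :=
  ∑ k ∈ Finset.range (r + 1), C ((-1) ^ k * hcomp k (aTuple ℓ lam a n)) * elemSym d J (r - k)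

/-- The deformed Tanisaki ideal `⟨𝒞^a_λ⟩`. -/
def tanIdeal (d ℓ : ℕ) (lam : ℕ → ℕ) (a : ℕ → ℂ) : Ideal (MvPolynomial (Fin d) ℂ) :=
  Ideal.span {g | ∃ n J r, n < ℓ ∧ J.card = d - n ∧
    d - n - mRem ℓ lam n < r ∧ r ≤ d - n ∧ g = tanGen d ℓ lam a n J r}

/-- `lam 0, lam 1, …, lam (ℓ-1)` is a partition of `d` with `ℓ` positive parts. -/
def IsPartitionOf (d ℓ : ℕ) (lam : ℕ → ℕ) : Prop :=
  0 < ℓ ∧ (∀ i j, i ≤ j → lam j ≤ lam i) ∧ (∀ i < ℓ, 0 < lam i) ∧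
    (∀ i, ℓ ≤ i → lam i = 0) ∧ ∑ i ∈ Finset.range ℓ, lam i = d

/-- `λ^t_i = #{rows j with λ_j ≥ i}` (here `i ≥ 1`). -/
def lamT (ℓ : ℕ) (lam : ℕ → ℕ) (i : ℕ) : ℕ :=
  ((Finset.range ℓ).filter fun j => i ≤ lam j).card

/-- The deformed Tanisaki–Garsia–Procesi algebra `R_a(λ)`. -/
abbrev TGPAlg (d ℓ : ℕ) (lam : ℕ → ℕ) (a : ℕ → ℂ) :=
  MvPolynomial (Fin d) ℂ ⧸ tanIdeal d ℓ lam a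


/-- Generating series of the signed complete homogeneous functions. -/
def hSer (L : List ℂ) : PowerSeries ℂ := PowerSeries.mk fun k => (-1) ^ k * hcomp k L

/-- The linear factor `1 + x q`. -/
def linF (x : ℂ) : PowerSeries ℂ := 1 + PowerSeries.C x * PowerSeries.X

/-- The index tuple underlying `aTuple`. -/
def idxTuple (ℓ : ℕ) (lam : ℕ → ℕ) (n : ℕ) : List ℕ :=
  ((List.range ℓ).drop n).flatMap fun i => List.range (lam i)

lemma hSer_nil : hSer [] = 1 := by
  ext k
  cases k <;> simp [hSer, hcomp, PowerSeries.coeff_one]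

lemma hSer_cons (x : ℂ) (L : List ℂ) : hSer (x :: L) * linF x = hSer L := by
  ext k
  have e : hSer (x :: L) * linF x
      = hSer (x :: L) + PowerSeries.C x * (hSer (x :: L) * PowerSeries.X) := by
    unfold linF; ring
  rw [e]
  cases k with
  | zero => simp [hSer, hcomp]
  | succ k =>
    rw [map_add, PowerSeries.coeff_C_mul, PowerSeries.coeff_succ_mul_X]
    simp only [hSer, PowerSeries.coeff_mk, hcomp]
    ring

lemma hSer_mul (L : List ℂ) : hSer L * (L.map linF).prod = 1 := by
  induction L with
  | nil => simp [hSer_nil]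
  | cons x L ih => rw [List.map_cons, List.prod_cons, ← mul_assoc, hSer_cons, ih]

lemma coeff_prod_linF {d : ℕ} (t : Fin d → ℂ) (J : Finset (Fin d)) (r : ℕ) :
    PowerSeries.coeff r (∏ j ∈ J, linF (t j)) = eval t (elemSym d J r) := by
  classical
  unfold linF
  rw [Finset.prod_one_add, map_sum]
  have h : ∀ s ∈ J.powerset, PowerSeries.coeff r (∏ i ∈ s, (PowerSeries.C (t i) * PowerSeries.X))
      = if s.card = r then ∏ i ∈ s, t i else 0 := by
    intro s _
    rw [Finset.prod_mul_distrib, Finset.prod_const, ← map_prod, PowerSeries.coeff_C_mul,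
      PowerSeries.coeff_X_pow]
    simp [eq_comm]
  rw [Finset.sum_congr rfl h, ← Finset.sum_filter, ← Finset.powersetCard_eq_filter]
  simp [elemSym]

lemma coeff_multiset_linF (M : Multiset ℂ) (r : ℕ) (h : M.card < r) :
    PowerSeries.coeff r (M.map linF).prod = 0 := by
  induction M using Multiset.induction generalizing r with
  | empty =>
    simp only [Multiset.card_zero] at h
    simp [PowerSeries.coeff_one, h.ne']
  | cons x M ih =>
    rw [Multiset.card_cons] at h
    obtain ⟨k, rfl⟩ : ∃ k, r = k + 1 := ⟨r - 1, by omega⟩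
    have e : linF x * (M.map linF).prod = (M.map linF).prod
      + PowerSeries.C x * ((M.map linF).prod * PowerSeries.X) := by
      unfold linF; ring
    rw [Multiset.map_cons, Multiset.prod_cons, e, map_add, PowerSeries.coeff_C_mul,
      PowerSeries.coeff_succ_mul_X, ih _ (by omega), ih _ (by omega)]
    simp

lemma eval_tanGen (d ℓ : ℕ) (lam : ℕ → ℕ) (a : ℕ → ℂ) (n : ℕ) (J : Finset (Fin d)) (r : ℕ)
    (t : Fin d → ℂ) : eval t (tanGen d ℓ lam a n J r)
      = PowerSeries.coeff r (hSer (aTuple ℓ lam a n) * ∏ j ∈ J, linF (t j)) := by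
  rw [PowerSeries.coeff_mul, Finset.Nat.sum_antidiagonal_eq_sum_range_succ_mk, tanGen, map_sum]
  refine Finset.sum_congr rfl fun k _ => ?_
  simp only [coeff_prod_linF, hSer, PowerSeries.coeff_mk, map_mul, eval_C]

lemma drop_range_eq (ℓ n : ℕ) : (List.range ℓ).drop n = List.range' n (ℓ - n) := by
  rw [List.range_eq_range', List.drop_range']
  simp

lemma list_sum_range' (f : ℕ → ℕ) (ℓ n : ℕ) :
    ((List.range' n (ℓ - n)).map f).sum = ∑ i ∈ Finset.Ico n ℓ, f i := rfl

lemma length_idx (ℓ : ℕ) (lam : ℕ → ℕ) (n : ℕ) :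
    (idxTuple ℓ lam n).length = mRem ℓ lam n := by
  rw [idxTuple, List.length_flatMap, drop_range_eq, mRem, list_sum_range']
  simp

lemma count_idx (ℓ : ℕ) (lam : ℕ → ℕ) (n c : ℕ) :
    (idxTuple ℓ lam n).count c = ((Finset.Ico n ℓ).filter fun i => c < lam i).card := by
  rw [idxTuple, List.count_flatMap, drop_range_eq, list_sum_range', Finset.card_filter]
  refine Finset.sum_congr rfl fun i _ => ?_
  simp [List.count_range]

lemma aTuple_eq (ℓ : ℕ) (lam : ℕ → ℕ) (a : ℕ → ℂ) (n : ℕ) :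
    aTuple ℓ lam a n = (idxTuple ℓ lam n).map a := by
  rw [aTuple, idxTuple, List.map_flatMap]

lemma idx_le (d ℓ : ℕ) (lam : ℕ → ℕ) (hmono : ∀ i j, i ≤ j → lam j ≤ lam i)
    (φ : Fin d → Fin (lam 0))
    (hφ : ∀ i : Fin (lam 0), Nat.card {j : Fin d // φ j = i} = lamT ℓ lam (i.1 + 1))
    (n : ℕ) (J : Finset (Fin d)) (hJ : J.card = d - n) :
    (idxTuple ℓ lam n : Multiset ℕ) ≤ J.val.map fun j => (φ j).1 := by
  classical
  rw [Multiset.le_iff_count]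
  intro c
  rw [Multiset.coe_count, count_idx]
  by_cases hc : c < lam 0
  · have h1 := hφ ⟨c, hc⟩
    rw [Nat.card_eq_fintype_card, Fintype.card_subtype] at h1
    change _ = lamT ℓ lam (c + 1) at h1
    have h2 : Multiset.count c (J.val.map fun j => (φ j).1)
        = (J.filter fun j => φ j = ⟨c, hc⟩).card := by
      rw [Multiset.count_map, Finset.card, Finset.filter_val]
      congr 1
      refine Multiset.filter_congr fun j _ => ?_
      rw [Fin.ext_iff, eq_comm]
    rw [h2]
    have h3 : (Finset.univ.filter fun j => φ j = ⟨c, hc⟩)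
        ⊆ (J.filter fun j => φ j = ⟨c, hc⟩) ∪ Jᶜ := by
      intro j hj
      by_cases hjJ : j ∈ J <;> simp_all
    have h4 := (Finset.card_le_card h3).trans (Finset.card_union_le _ _)
    rw [Finset.card_compl, Fintype.card_fin, hJ, h1, lamT] at h4
    rcases ((Finset.Ico n ℓ).filter fun i => c < lam i).eq_empty_or_nonempty with h5 | ⟨i, hi⟩
    · rw [h5]; simp
    · simp only [Finset.mem_filter, Finset.mem_Ico] at hi
      have h6 : Finset.range n ∪ ((Finset.Ico n ℓ).filter fun i => c < lam i)
          ⊆ (Finset.range ℓ).filter fun j => c + 1 ≤ lam j := by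
        intro j hj
        simp only [Finset.mem_union, Finset.mem_range, Finset.mem_filter, Finset.mem_Ico] at hj ⊢
        rcases hj with hj | hj
        · have := hmono j i (by omega)
          omega
        · omega
      have h7 : Disjoint (Finset.range n) ((Finset.Ico n ℓ).filter fun i => c < lam i) := by
        rw [Finset.disjoint_left]
        intro j hj hj'
        simp only [Finset.mem_range, Finset.mem_filter, Finset.mem_Ico] at hj hj'
        omega
      have h8 := Finset.card_le_card h6
      rw [Finset.card_union_of_disjoint h7, Finset.card_range] at h8
      omega
  · rw [Finset.card_eq_zero.2]
    · exact Nat.zero_le _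
    · refine Finset.filter_eq_empty_iff.2 fun i _ hi => hc (hi.trans_le (hmono 0 i (Nat.zero_le _)))

/-- if `φ : {1,…,d} → {1,…,p}` has `#φ⁻¹(i) = λ^t_i` for all `i`, then every
element of the deformed Tanisaki ideal vanishes at `(a_{φ(1)},…,a_{φ(d)})`. -/
theorem deformed_TGP_vanishing (d ℓ : ℕ) (lam : ℕ → ℕ) (hpart : IsPartitionOf d ℓ lam)
    (a : ℕ → ℂ) (φ : Fin d → Fin (lam 0))
    (hφ : ∀ i : Fin (lam 0), Nat.card {j : Fin d // φ j = i} = lamT ℓ lam (i.1 + 1)) :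
    ∀ f ∈ tanIdeal d ℓ lam a, eval (fun j : Fin d => a (φ j).1) f = 0 := by
  intro f hf
  obtain ⟨-, hmono, -, -, -⟩ := hpart
  suffices h : tanIdeal d ℓ lam a ≤ RingHom.ker (eval (fun j : Fin d => a (φ j).1)) from h hf
  refine Ideal.span_le.2 ?_
  rintro g ⟨n, J, r, -, hJ, hr, -, rfl⟩
  change eval _ _ = 0
  obtain ⟨K, hK⟩ := Multiset.le_iff_exists_add.1 (idx_le d ℓ lam hmono φ hφ n J hJ)
  have hcard := congrArg Multiset.card hK
  simp only [Multiset.card_map, Finset.card_val, Multiset.card_add, Multiset.coe_card,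
    length_idx, hJ] at hcard
  have hprod : ∏ j ∈ J, linF (a (φ j).1)
      = ((aTuple ℓ lam a n).map linF).prod * ((K.map a).map linF).prod := by
    have := congrArg (fun M => ((M.map a).map linF).prod) hK
    simp only [Multiset.map_add, Multiset.prod_add, Multiset.map_map, Multiset.map_coe,
      Multiset.prod_coe, Function.comp_def] at this
    rw [aTuple_eq, List.map_map, Multiset.map_map]
    rw [List.map_map] at this
    exact this
  rw [eval_tanGen, hprod, ← mul_assoc, hSer_mul, one_mul]
  refine coeff_multiset_linF _ _ ?_
  rw [Multiset.card_map]
  omega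

end
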